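/- arXiv:2111.14539 — 7 statements merged into one kernel-verified Lean document; each statement's English description precedes it below -/
import Mathlib

section
/- Consider the nonrelativistic upper hybrid oscillation system for functions V1, V2, E1 of (ρ,θ): ∂V1/∂θ + V1 ∂V1/∂ρ = −E1 − B0 V2, ∂V2/∂θ + V1 ∂V2/∂ρ = B0 V1, ∂E1/∂θ + V1 ∂E1/∂ρ = V1, with C² initial data V1⁰, V2⁰, E1⁰. If there exists a point ρ₀ ∈ ℝ at which Δ(ρ₀) = ((V1⁰)′(ρ₀))² + 2(E1⁰)′(ρ₀) + 2B0 (V2⁰)′(ρ₀) − B0² − 1 ≥ 0, then the solution loses C¹ smoothness in finite time: there is no global C¹ solution on ℝ × [0,∞); the spatial derivatives of the solution become infinite at some finite time. -/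
open Real Set

/-- Partial derivative in time `θ`, taken within the time domain `[0,∞)`. -/
noncomputable def pdTheta (f : ℝ → ℝ → ℝ) (ρ θ : ℝ) : ℝ :=
  derivWithin (fun t => f ρ t) (Set.Ici 0) θ

/-- Partial derivative in space `ρ`. -/
noncomputable def pdRho (f : ℝ → ℝ → ℝ) (ρ θ : ℝ) : ℝ :=
  deriv (fun x => f x θ) ρ

/-- `(V1, V2, E1)` is a global `C¹` solution on `ℝ × [0,∞)` of the nonrelativistic
upper hybrid oscillation system with external magnetic field `B0`. -/
def IsNonrelSolution (B0 : ℝ) (V1 V2 E1 : ℝ → ℝ → ℝ) : Prop :=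
  ContDiffOn ℝ 1 (fun p : ℝ × ℝ => (V1 p.1 p.2, V2 p.1 p.2, E1 p.1 p.2))
    (Set.univ ×ˢ Set.Ici 0) ∧
  ∀ ρ θ : ℝ, 0 ≤ θ →
    pdTheta V1 ρ θ + V1 ρ θ * pdRho V1 ρ θ = -(E1 ρ θ) - B0 * V2 ρ θ ∧
    pdTheta V2 ρ θ + V1 ρ θ * pdRho V2 ρ θ = B0 * V1 ρ θ ∧
    pdTheta E1 ρ θ + V1 ρ θ * pdRho E1 ρ θ = V1 ρ θ

/-- The closed space-time half-plane `ℝ × [0,∞)`. -/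
def halfPlane : Set (ℝ × ℝ) :=
  univ ×ˢ Ici 0

@[simp]
theorem mem_halfPlane {p : ℝ × ℝ} : p ∈ halfPlane ↔ 0 ≤ p.2 := by
  simp [halfPlane]

theorem uniqueDiffOn_halfPlane : UniqueDiffOn ℝ halfPlane :=
  uniqueDiffOn_univ.prod (uniqueDiffOn_Ici 0)

theorem hasDerivAt_space {f : ℝ → ℝ → ℝ}
    (hf : ContDiffOn ℝ 1 (fun p : ℝ × ℝ => f p.1 p.2) halfPlane) (x : ℝ) {θ : ℝ} (hθ : 0 ≤ θ) :
    HasDerivAt (fun y => f y θ)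
      (fderivWithin ℝ (fun p : ℝ × ℝ => f p.1 p.2) halfPlane (x, θ) (1, 0)) x := by
  have hd := ((hf.differentiableOn one_ne_zero) (x, θ) (by simpa using hθ)).hasFDerivWithinAt
  have hc : HasDerivWithinAt (fun y : ℝ => (y, θ)) (1, 0) univ x :=
    ((hasDerivAt_id x).prodMk (hasDerivAt_const x θ)).hasDerivWithinAt
  have h := hd.comp_hasDerivWithinAt x hc (fun y _ => by simpa using hθ)
  exact h.hasDerivAt Filter.univ_mem

theorem pdRho_eq_fderivWithin {f : ℝ → ℝ → ℝ}
    (hf : ContDiffOn ℝ 1 (fun p : ℝ × ℝ => f p.1 p.2) halfPlane) (x : ℝ) {θ : ℝ} (hθ : 0 ≤ θ) :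
    pdRho f x θ = fderivWithin ℝ (fun p : ℝ × ℝ => f p.1 p.2) halfPlane (x, θ) (1, 0) :=
  (hasDerivAt_space hf x hθ).deriv

theorem hasDerivAt_pdRho {f : ℝ → ℝ → ℝ}
    (hf : ContDiffOn ℝ 1 (fun p : ℝ × ℝ => f p.1 p.2) halfPlane) (x : ℝ) {θ : ℝ} (hθ : 0 ≤ θ) :
    HasDerivAt (fun y => f y θ) (pdRho f x θ) x :=
  (hasDerivAt_space hf x hθ).differentiableAt.hasDerivAt

theorem pdTheta_eq_fderivWithin {f : ℝ → ℝ → ℝ}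
    (hf : ContDiffOn ℝ 1 (fun p : ℝ × ℝ => f p.1 p.2) halfPlane) (x : ℝ) {θ : ℝ} (hθ : 0 ≤ θ) :
    pdTheta f x θ = fderivWithin ℝ (fun p : ℝ × ℝ => f p.1 p.2) halfPlane (x, θ) (0, 1) := by
  have hd := ((hf.differentiableOn one_ne_zero) (x, θ) (by simpa using hθ)).hasFDerivWithinAt
  have hc : HasDerivWithinAt (fun t : ℝ => (x, t)) (0, 1) (Ici 0) θ :=
    ((hasDerivAt_const θ x).prodMk (hasDerivAt_id θ)).hasDerivWithinAt
  have h := hd.comp_hasDerivWithinAt θ hc (fun t ht => by simpa using ht)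
  exact h.derivWithin (uniqueDiffOn_Ici 0 θ hθ)

theorem continuousOn_pdRho {f : ℝ → ℝ → ℝ}
    (hf : ContDiffOn ℝ 1 (fun p : ℝ × ℝ => f p.1 p.2) halfPlane) :
    ContinuousOn (fun p : ℝ × ℝ => pdRho f p.1 p.2) halfPlane :=
  ((hf.continuousOn_fderivWithin uniqueDiffOn_halfPlane le_rfl).clm_apply
    continuousOn_const).congr fun p hp => pdRho_eq_fderivWithin hf p.1 (mem_halfPlane.1 hp)

/-- Chain rule for a function on the half-plane along the graph of a curve. -/
theorem hasDerivWithinAt_along {f : ℝ → ℝ → ℝ}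
    (hf : ContDiffOn ℝ 1 (fun p : ℝ × ℝ => f p.1 p.2) halfPlane) {Y : ℝ → ℝ} {y' θ : ℝ}
    (hθ : 0 ≤ θ) (hY : HasDerivAt Y y' θ) :
    HasDerivWithinAt (fun t => f (Y t) t)
      (pdTheta f (Y θ) θ + y' * pdRho f (Y θ) θ) (Ici 0) θ := by
  have hd := ((hf.differentiableOn one_ne_zero) (Y θ, θ) (by simpa using hθ)).hasFDerivWithinAt
  have hc : HasDerivWithinAt (fun t : ℝ => (Y t, t)) (y', 1) (Ici 0) θ :=
    (hY.prodMk (hasDerivAt_id θ)).hasDerivWithinAt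
  have h := HasFDerivWithinAt.comp_hasDerivWithinAt (f := fun t => (Y t, t)) θ hd hc (fun t ht => by simpa using ht)
  refine h.congr_deriv ?_
  rw [pdTheta_eq_fderivWithin hf _ hθ, pdRho_eq_fderivWithin hf _ hθ, ← smul_eq_mul,
    ← map_smul, ← map_add]
  simp

theorem exists_bound_pdRho_along {f : ℝ → ℝ → ℝ}
    (hf : ContDiffOn ℝ 1 (fun p : ℝ × ℝ => f p.1 p.2) halfPlane) {Y : ℝ → ℝ}
    (hY : Continuous Y) (T : ℝ) :
    ∃ M, ∀ θ ∈ Icc 0 T, |pdRho f (Y θ) θ| ≤ M := by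
  have h : ContinuousOn (fun θ => pdRho f (Y θ) θ) (Icc 0 T) :=
    (continuousOn_pdRho hf).comp (f := fun θ => (Y θ, θ))
      (hY.prodMk continuous_id).continuousOn (fun θ hθ => by simpa using hθ.1)
  exact isCompact_Icc.exists_bound_of_continuousOn h

/-- A curve that satisfies the second-order equation of the characteristics, with matching initial
data, is a characteristic, and `V2`, `E1` grow along it as the displacement does. -/
theorem solution_along_characteristic {B0 : ℝ} {V1 V2 E1 : ℝ → ℝ → ℝ}
    (hV1 : ContDiffOn ℝ 1 (fun p : ℝ × ℝ => V1 p.1 p.2) halfPlane)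
    (hV2 : ContDiffOn ℝ 1 (fun p : ℝ × ℝ => V2 p.1 p.2) halfPlane)
    (hE1 : ContDiffOn ℝ 1 (fun p : ℝ × ℝ => E1 p.1 p.2) halfPlane)
    (heq : ∀ ρ θ : ℝ, 0 ≤ θ →
      pdTheta V1 ρ θ + V1 ρ θ * pdRho V1 ρ θ = -(E1 ρ θ) - B0 * V2 ρ θ ∧
      pdTheta V2 ρ θ + V1 ρ θ * pdRho V2 ρ θ = B0 * V1 ρ θ ∧
      pdTheta E1 ρ θ + V1 ρ θ * pdRho E1 ρ θ = V1 ρ θ)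
    {Y U : ℝ → ℝ} {ρ : ℝ} (hY : ∀ θ, HasDerivAt Y (U θ) θ)
    (hU : ∀ θ, HasDerivAt U (-(E1 ρ 0 + (Y θ - ρ)) - B0 * (V2 ρ 0 + B0 * (Y θ - ρ))) θ)
    (hY0 : Y 0 = ρ) (hU0 : U 0 = V1 ρ 0) {T : ℝ} (hT : 0 ≤ T) :
    V1 (Y T) T = U T ∧ V2 (Y T) T = V2 ρ 0 + B0 * (Y T - ρ) ∧
      E1 (Y T) T = E1 ρ 0 + (Y T - ρ) := by
  have hYc : Continuous Y := continuous_iff_continuousAt.2 fun θ => (hY θ).continuousAt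
  obtain ⟨M₁, hM₁⟩ := exists_bound_pdRho_along hV1 hYc T
  obtain ⟨M₂, hM₂⟩ := exists_bound_pdRho_along hV2 hYc T
  obtain ⟨M₃, hM₃⟩ := exists_bound_pdRho_along hE1 hYc T
  set z : ℝ → ℝ × ℝ × ℝ := fun θ => (V1 (Y θ) θ - U θ,
    V2 (Y θ) θ - (V2 ρ 0 + B0 * (Y θ - ρ)), E1 (Y θ) θ - (E1 ρ 0 + (Y θ - ρ))) with hz
  set z' : ℝ → ℝ × ℝ × ℝ := fun θ =>
    (-(z θ).2.2 - B0 * (z θ).2.1 - (z θ).1 * pdRho V1 (Y θ) θ,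
      B0 * (z θ).1 - (z θ).1 * pdRho V2 (Y θ) θ, (z θ).1 - (z θ).1 * pdRho E1 (Y θ) θ) with hz'
  have hder : ∀ θ, 0 ≤ θ → HasDerivWithinAt z (z' θ) (Ici 0) θ := by
    intro θ hθ
    obtain ⟨h1, h2, h3⟩ := heq (Y θ) θ hθ
    have hYρ := ((hY θ).sub_const ρ).hasDerivWithinAt (s := Ici 0)
    refine HasDerivWithinAt.prodMk ?_ (HasDerivWithinAt.prodMk ?_ ?_)
    · refine ((hasDerivWithinAt_along hV1 hθ (hY θ)).sub (hU θ).hasDerivWithinAt).congr_deriv ?_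
      simp only [hz]
      linear_combination h1
    · refine ((hasDerivWithinAt_along hV2 hθ (hY θ)).sub
        ((hYρ.const_mul B0).const_add (V2 ρ 0))).congr_deriv ?_
      simp only [hz]
      linear_combination h2
    · refine ((hasDerivWithinAt_along hE1 hθ (hY θ)).sub
        (hYρ.const_add (E1 ρ 0))).congr_deriv ?_
      simp only [hz]
      linear_combination h3
  have hbound : ∀ θ ∈ Ico 0 T,
      ‖z' θ‖ ≤ (1 + |B0| + |M₁| + |M₂| + |M₃|) * ‖z θ‖ + 0 := by
    intro θ hθ
    have b1 := (hM₁ θ (Ico_subset_Icc_self hθ)).trans (le_abs_self M₁)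
    have b2 := (hM₂ θ (Ico_subset_Icc_self hθ)).trans (le_abs_self M₂)
    have b3 := (hM₃ θ (Ico_subset_Icc_self hθ)).trans (le_abs_self M₃)
    have n1 : |(z θ).1| ≤ ‖z θ‖ := norm_fst_le (z θ)
    have n2 : |(z θ).2.1| ≤ ‖z θ‖ := (norm_fst_le (z θ).2).trans (norm_snd_le (z θ))
    have n3 : |(z θ).2.2| ≤ ‖z θ‖ := (norm_snd_le (z θ).2).trans (norm_snd_le (z θ))
    have hn := norm_nonneg (z θ)
    have m1 := mul_le_mul n1 b1 (abs_nonneg _) hn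
    have m2 := mul_le_mul n1 b2 (abs_nonneg _) hn
    have m3 := mul_le_mul n1 b3 (abs_nonneg _) hn
    have m4 := mul_le_mul_of_nonneg_left n2 (abs_nonneg B0)
    have m5 := mul_le_mul_of_nonneg_left n1 (abs_nonneg B0)
    have p0 := mul_nonneg hn (abs_nonneg B0)
    have p1 := mul_nonneg hn (abs_nonneg M₁)
    have p2 := mul_nonneg hn (abs_nonneg M₂)
    have p3 := mul_nonneg hn (abs_nonneg M₃)
    rw [← abs_mul] at m1 m2 m3 m4 m5
    have a1 := abs_sub (-(z θ).2.2 - B0 * (z θ).2.1) ((z θ).1 * pdRho V1 (Y θ) θ)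
    have a1' := abs_sub (-(z θ).2.2) (B0 * (z θ).2.1)
    have a2 := abs_sub (B0 * (z θ).1) ((z θ).1 * pdRho V2 (Y θ) θ)
    have a3 := abs_sub (z θ).1 ((z θ).1 * pdRho E1 (Y θ) θ)
    rw [abs_neg] at a1'
    refine norm_prod_le_iff.2 ⟨?_, norm_prod_le_iff.2 ⟨?_, ?_⟩⟩ <;>
      simp only [hz', Real.norm_eq_abs] <;> linarith
  have hzero : ‖z T‖ ≤ gronwallBound 0 (1 + |B0| + |M₁| + |M₂| + |M₃|) 0 (T - 0) :=
    norm_le_gronwallBound_of_norm_deriv_right_le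
      (fun θ hθ => ((hder θ hθ.1).continuousWithinAt).mono Icc_subset_Ici_self)
      (fun θ hθ => (hder θ hθ.1).mono (Ici_subset_Ici.2 hθ.1))
      (by simp [hz, hY0, hU0]) hbound T ⟨hT, le_rfl⟩
  rw [gronwallBound_ε0, zero_mul] at hzero
  have hzT : z T = 0 := norm_le_zero_iff.1 hzero
  simp only [hz, Prod.mk_eq_zero, sub_eq_zero] at hzT
  exact hzT

theorem exists_pos_trig_eq_zero {b c : ℝ} (h : 1 ≤ b ^ 2 + 2 * c) :
    ∃ φ : ℝ, 0 < φ ∧ 1 - c + c * cos φ + b * sin φ = 0 := by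
  set z : ℂ := ⟨-c, -b⟩
  have hre : ‖z‖ * cos (z.arg + 2 * π) = -c := by
    rw [cos_add_two_pi]; exact Complex.norm_mul_cos_arg z
  have him : ‖z‖ * sin (z.arg + 2 * π) = -b := by
    rw [sin_add_two_pi]; exact Complex.norm_mul_sin_arg z
  have hr : ‖z‖ ^ 2 = c ^ 2 + b ^ 2 := by
    linear_combination (-c + ‖z‖ * cos (z.arg + 2 * π)) * hre +
      (-b + ‖z‖ * sin (z.arg + 2 * π)) * him - ‖z‖ ^ 2 * sin_sq_add_cos_sq (z.arg + 2 * π)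
  have hle : 1 - c ≤ ‖z‖ := abs_le_of_sq_le_sq' (by nlinarith) (norm_nonneg z) |>.2
  have hrpos : 0 < ‖z‖ := by
    refine (norm_nonneg z).lt_of_ne' fun h0 => ?_
    rw [h0] at hr
    nlinarith [sq_nonneg b, sq_nonneg c]
  have hpos : 0 ≤ z.arg + 2 * π := by linarith [Complex.neg_pi_lt_arg z, pi_pos]
  have hneg : 1 - c + c * cos (z.arg + 2 * π) + b * sin (z.arg + 2 * π) ≤ 0 := by
    refine nonpos_of_mul_nonpos_right (a := ‖z‖) ?_ hrpos
    have : ‖z‖ * (1 - c + c * cos (z.arg + 2 * π) + b * sin (z.arg + 2 * π)) =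
        ‖z‖ * (1 - c - ‖z‖) := by linear_combination c * hre + b * him + hr
    rw [this]
    exact mul_nonpos_of_nonneg_of_nonpos hrpos.le (by linarith)
  have hcont : ContinuousOn (fun φ : ℝ => 1 - c + c * cos φ + b * sin φ)
      (Icc 0 (z.arg + 2 * π)) := by fun_prop
  obtain ⟨φ, hφ, hφ0⟩ := intermediate_value_Icc' hpos hcont
    (show (0 : ℝ) ∈ _ from ⟨hneg, by simp⟩)
  refine ⟨φ, hφ.1.lt_of_ne fun h0 => ?_, hφ0⟩
  simp [← h0] at hφ0

/-- If `Δ(ρ₀) = ((V1⁰)′)² + 2(E1⁰)′ + 2B0(V2⁰)′ − B0² − 1 ≥ 0` at some point `ρ₀`, then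
the Cauchy problem for the nonrelativistic upper hybrid system has no global `C¹`
solution on `ℝ × [0,∞)`: smoothness is lost in finite time. -/
theorem nonrel_blowup_of_Delta_nonneg
    (B0 : ℝ) (V10 V20 E10 : ℝ → ℝ)
    (hV10 : ContDiff ℝ 2 V10) (hV20 : ContDiff ℝ 2 V20) (hE10 : ContDiff ℝ 2 E10)
    (hΔ : ∃ ρ₀ : ℝ,
      0 ≤ (deriv V10 ρ₀) ^ 2 + 2 * deriv E10 ρ₀ + 2 * B0 * deriv V20 ρ₀ - B0 ^ 2 - 1) :
    ¬ ∃ V1 V2 E1 : ℝ → ℝ → ℝ,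
        IsNonrelSolution B0 V1 V2 E1 ∧
        (∀ ρ : ℝ, V1 ρ 0 = V10 ρ ∧ V2 ρ 0 = V20 ρ ∧ E1 ρ 0 = E10 ρ) := by
  rintro ⟨V1, V2, E1, ⟨hC, heq⟩, hinit⟩
  obtain ⟨ρ₀, hρ₀⟩ := hΔ
  have hV1 : ContDiffOn ℝ 1 (fun p : ℝ × ℝ => V1 p.1 p.2) halfPlane := hC.fst
  have hV2 : ContDiffOn ℝ 1 (fun p : ℝ × ℝ => V2 p.1 p.2) halfPlane := hC.snd.fst
  have hE1 : ContDiffOn ℝ 1 (fun p : ℝ × ℝ => E1 p.1 p.2) halfPlane := hC.snd.snd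
  set ω : ℝ := √(1 + B0 ^ 2)
  have hω2 : ω ^ 2 = 1 + B0 ^ 2 := sq_sqrt (by positivity)
  have hω : 0 < ω := sqrt_pos.2 (by positivity)
  set q : ℝ → ℝ := fun ρ => E10 ρ + B0 * V20 ρ with hq
  set X : ℝ → ℝ → ℝ := fun ρ θ =>
    ρ + V10 ρ * (sin (ω * θ) / ω) - q ρ * ((1 - cos (ω * θ)) / ω ^ 2) with hX
  set U : ℝ → ℝ → ℝ := fun ρ θ => V10 ρ * cos (ω * θ) - q ρ * (sin (ω * θ) / ω) with hUdef
  have hlin : ∀ θ, HasDerivAt (fun t => ω * t) ω θ := fun θ => by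
    simpa using (hasDerivAt_id θ).const_mul ω
  have hXU : ∀ ρ θ, HasDerivAt (X ρ) (U ρ θ) θ := by
    intro ρ θ
    refine (((((hlin θ).sin.div_const ω).const_mul (V10 ρ)).const_add ρ).sub
      ((((hlin θ).cos.const_sub 1).div_const (ω ^ 2)).const_mul (q ρ))).congr_deriv ?_
    simp only [hUdef]
    field_simp
  have hchar : ∀ ρ, ∀ T, 0 ≤ T → V1 (X ρ T) T = U ρ T ∧
      V2 (X ρ T) T = V20 ρ + B0 * (X ρ T - ρ) ∧ E1 (X ρ T) T = E10 ρ + (X ρ T - ρ) := by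
    intro ρ T hT
    obtain ⟨i1, i2, i3⟩ := hinit ρ
    rw [← i2, ← i3]
    refine solution_along_characteristic hV1 hV2 hE1 heq (hXU ρ) (fun θ => ?_)
      (by simp [hX]) (by simp [hUdef, i1]) hT
    refine (((hlin θ).cos.const_mul (V10 ρ)).sub
      (((hlin θ).sin.div_const ω).const_mul (q ρ))).congr_deriv ?_
    have hXω : ω ^ 2 * (X ρ θ - ρ) = V10 ρ * (ω * sin (ω * θ)) - q ρ * (1 - cos (ω * θ)) := by
      simp only [hX]
      field_simp
      ring
    have hdiv : cos (ω * θ) * ω / ω = cos (ω * θ) := by field_simp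
    rw [hdiv, i2, i3]
    linear_combination hXω - (X ρ θ - ρ) * hω2
  have dV1 := (hV10.differentiable two_ne_zero ρ₀).hasDerivAt
  have dV2 := (hV20.differentiable two_ne_zero ρ₀).hasDerivAt
  have dE1 := (hE10.differentiable two_ne_zero ρ₀).hasDerivAt
  set a := deriv V10 ρ₀
  set v := deriv V20 ρ₀
  set e := deriv E10 ρ₀
  have dq : HasDerivAt q (e + B0 * v) ρ₀ := dE1.add (dV2.const_mul B0)
  obtain ⟨φ, hφ, hJ⟩ := exists_pos_trig_eq_zero (b := a / ω) (c := (e + B0 * v) / ω ^ 2) (by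
    rw [div_pow, ← mul_div_assoc, ← add_div, one_le_div (by positivity)]
    linarith)
  set T := φ / ω
  have hT : 0 < T := div_pos hφ hω
  have hωT : ω * T = φ := mul_div_cancel₀ φ hω.ne'
  have dX : HasDerivAt (fun ρ => X ρ T) 0 ρ₀ := by
    refine (((hasDerivAt_id ρ₀).add (dV1.mul_const (sin (ω * T) / ω))).sub
      (dq.mul_const ((1 - cos (ω * T)) / ω ^ 2))).congr_deriv ?_
    rw [hωT]
    linear_combination hJ
  have dcomp {f : ℝ → ℝ → ℝ} (hf : ContDiffOn ℝ 1 (fun p : ℝ × ℝ => f p.1 p.2) halfPlane) :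
      HasDerivAt (fun ρ => f (X ρ T) T) 0 ρ₀ :=
    (HasDerivAt.comp (h₂ := fun x => f x T) ρ₀ (hasDerivAt_pdRho hf (X ρ₀ T) hT.le) dX).congr_deriv (mul_zero _)
  have dXρ : HasDerivAt (fun ρ => X ρ T - ρ) (0 - 1) ρ₀ := dX.sub (hasDerivAt_id ρ₀)
  have he : e + (0 - 1) = 0 := (dE1.add dXρ).unique
    ((dcomp hE1).congr_of_eventuallyEq (.of_forall fun ρ => ((hchar ρ T hT.le).2.2).symm))
  have hv : v + B0 * (0 - 1) = 0 := (dV2.add (dXρ.const_mul B0)).unique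
    ((dcomp hV2).congr_of_eventuallyEq (.of_forall fun ρ => ((hchar ρ T hT.le).2.1).symm))
  have hu : a * cos (ω * T) - (e + B0 * v) * (sin (ω * T) / ω) = 0 :=
    ((dV1.mul_const (cos (ω * T))).sub (dq.mul_const (sin (ω * T) / ω))).unique
      ((dcomp hV1).congr_of_eventuallyEq (.of_forall fun ρ => ((hchar ρ T hT.le).1).symm))
  have hs : e + B0 * v = ω ^ 2 := by linear_combination he + B0 * hv - hω2
  rw [hs, div_self (by positivity)] at hJ
  rw [hs, hωT] at hu
  have hu' : a * cos φ - ω * sin φ = 0 := by rw [← hu]; field_simp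
  have hJ' : ω * cos φ + a * sin φ = 0 := by
    have : ω * (1 - 1 + 1 * cos φ + a / ω * sin φ) = ω * cos φ + a * sin φ := by
      field_simp
      ring
    rw [← this, hJ, mul_zero]
  have : ω ^ 2 + a ^ 2 = 0 := by
    linear_combination (a * cos φ - ω * sin φ) * hu' + (ω * cos φ + a * sin φ) * hJ' -
      (ω ^ 2 + a ^ 2) * sin_sq_add_cos_sq φ
  nlinarith [sq_nonneg a, pow_pos hω 2]
end

section
/- Let B0 ∈ ℝ and let (P1, P2, E1) : I → ℝ³ be a C¹ solution on an interval I of the characteristic system dP1/dθ = −E1 − B0 P2/γ, dP2/dθ = B0 P1/γ, dE1/dθ = P1/γ, where γ = √(1 + P1² + P2²). Then the function θ ↦ 2√(1 + P1(θ)² + P2(θ)²) + E1(θ)² is constant on I. -/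
open Real Set

/-- The Lorentz factor `γ = √(1 + P1² + P2²)` along a characteristic. -/
noncomputable def gam (P1 P2 : ℝ → ℝ) (θ : ℝ) : ℝ :=
  Real.sqrt (1 + P1 θ ^ 2 + P2 θ ^ 2)

/-- Along any `C¹` solution of the characteristic system
`P1′ = −E1 − B0 P2/γ`, `P2′ = B0 P1/γ`, `E1′ = P1/γ` on an interval `I`,
the quantity `2√(1 + P1² + P2²) + E1²` is constant. -/
theorem first_integral_K2
    (B0 : ℝ) (I : Set ℝ) (hI : Convex ℝ I) (P1 P2 E1 : ℝ → ℝ)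
    (hP1 : ∀ θ ∈ I, HasDerivAt P1 (-(E1 θ) - B0 * P2 θ / gam P1 P2 θ) θ)
    (hP2 : ∀ θ ∈ I, HasDerivAt P2 (B0 * P1 θ / gam P1 P2 θ) θ)
    (hE1 : ∀ θ ∈ I, HasDerivAt E1 (P1 θ / gam P1 P2 θ) θ) :
    ∀ s ∈ I, ∀ t ∈ I,
      2 * Real.sqrt (1 + P1 s ^ 2 + P2 s ^ 2) + E1 s ^ 2 =
      2 * Real.sqrt (1 + P1 t ^ 2 + P2 t ^ 2) + E1 t ^ 2 := by
  have hG : ∀ θ ∈ I, HasDerivWithinAt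
      (fun x => 2 * Real.sqrt (1 + P1 x ^ 2 + P2 x ^ 2) + E1 x ^ 2) 0 I θ := by
    intro θ hθ
    have hpos : 0 < 1 + P1 θ ^ 2 + P2 θ ^ 2 := by positivity
    have hγ : 0 < gam P1 P2 θ := Real.sqrt_pos.2 hpos
    have hsq := ((((hP1 θ hθ).pow 2).const_add 1).add ((hP2 θ hθ).pow 2)).sqrt hpos.ne'
    have h := (hsq.const_mul 2).add ((hE1 θ hθ).pow 2)
    refine (h.congr_deriv ?_).hasDerivWithinAt
    change 2 * (_ / (2 * gam P1 P2 θ)) + _ = 0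
    field_simp
    ring
  intro s hs t ht
  have h := hI.norm_image_sub_le_of_norm_hasDerivWithin_le (C := 0) hG (by simp) ht hs
  exact sub_eq_zero.1 (norm_le_zero_iff.1 (by simpa only [zero_mul] using h))
end

section
/- Let B0 ∈ ℝ and let (P1, P2, E1) : I → ℝ³ be a C¹ solution on an interval I containing 0 of the characteristic system dP1/dθ = −E1 − B0 P2/γ, dP2/dθ = B0 P1/γ, dE1/dθ = P1/γ, where γ = √(1 + P1² + P2²). Set K2 = 2√(1 + P1(0)² + P2(0)²) + E1(0)². Then for all θ ∈ I one has √(1 + P1(θ)² + P2(θ)²) ≤ K2/2 and E1(θ)² ≤ K2 − 2; in particular P1, P2 and E1 are bounded on I. -/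
open Real Set

theorem gam_pos (P1 P2 : ℝ → ℝ) (θ : ℝ) : 0 < gam P1 P2 θ :=
  Real.sqrt_pos.2 (by positivity)

theorem one_le_gam (P1 P2 : ℝ → ℝ) (θ : ℝ) : 1 ≤ gam P1 P2 θ :=
  Real.one_le_sqrt.2 (by nlinarith [sq_nonneg (P1 θ), sq_nonneg (P2 θ)])

theorem abs_fst_le_gam (P1 P2 : ℝ → ℝ) (θ : ℝ) : |P1 θ| ≤ gam P1 P2 θ :=
  Real.abs_le_sqrt (by nlinarith [sq_nonneg (P2 θ)])

theorem abs_snd_le_gam (P1 P2 : ℝ → ℝ) (θ : ℝ) : |P2 θ| ≤ gam P1 P2 θ :=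
  Real.abs_le_sqrt (by nlinarith [sq_nonneg (P1 θ)])

theorem hasDerivWithinAt_gam {P1 P2 : ℝ → ℝ} {a b θ : ℝ} {s : Set ℝ}
    (h1 : HasDerivWithinAt P1 a s θ) (h2 : HasDerivWithinAt P2 b s θ) :
    HasDerivWithinAt (gam P1 P2) ((P1 θ * a + P2 θ * b) / gam P1 P2 θ) s θ := by
  have h := (((h1.fun_pow 2).const_add 1).fun_add (h2.fun_pow 2)).sqrt (by positivity)
  refine h.congr_deriv ?_
  change _ / (2 * gam P1 P2 θ) = _
  have := (gam_pos P1 P2 θ).ne'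
  field_simp
  ring

/-- The quantity `2γ + E1²` has zero derivative along the characteristic system. -/
theorem hasDerivWithinAt_energy {B0 θ : ℝ} {s : Set ℝ} {P1 P2 E1 : ℝ → ℝ}
    (h1 : HasDerivWithinAt P1 (-(E1 θ) - B0 * P2 θ / gam P1 P2 θ) s θ)
    (h2 : HasDerivWithinAt P2 (B0 * P1 θ / gam P1 P2 θ) s θ)
    (h3 : HasDerivWithinAt E1 (P1 θ / gam P1 P2 θ) s θ) :
    HasDerivWithinAt (fun t => 2 * gam P1 P2 t + E1 t ^ 2) 0 s θ := by
  refine (((hasDerivWithinAt_gam h1 h2).const_mul 2).fun_add (h3.fun_pow 2)).congr_deriv ?_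
  have := (gam_pos P1 P2 θ).ne'
  field_simp
  ring

/-- Along any `C¹` solution of the characteristic system on an interval `I ∋ 0`, with
`K2 = 2√(1 + P1(0)² + P2(0)²) + E1(0)²`, one has `γ ≤ K2/2` and `E1² ≤ K2 − 2` on `I`;
in particular `P1`, `P2`, `E1` are bounded on `I`. -/
theorem solution_components_bounded
    (B0 : ℝ) (I : Set ℝ) (hI : Convex ℝ I) (h0 : (0 : ℝ) ∈ I) (P1 P2 E1 : ℝ → ℝ)
    (hP1 : ∀ θ ∈ I, HasDerivAt P1 (-(E1 θ) - B0 * P2 θ / gam P1 P2 θ) θ)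
    (hP2 : ∀ θ ∈ I, HasDerivAt P2 (B0 * P1 θ / gam P1 P2 θ) θ)
    (hE1 : ∀ θ ∈ I, HasDerivAt E1 (P1 θ / gam P1 P2 θ) θ)
    (K2 : ℝ) (hK2 : K2 = 2 * Real.sqrt (1 + P1 0 ^ 2 + P2 0 ^ 2) + E1 0 ^ 2) :
    (∀ θ ∈ I, Real.sqrt (1 + P1 θ ^ 2 + P2 θ ^ 2) ≤ K2 / 2 ∧ E1 θ ^ 2 ≤ K2 - 2) ∧
    (∃ M : ℝ, ∀ θ ∈ I, |P1 θ| ≤ M ∧ |P2 θ| ≤ M ∧ |E1 θ| ≤ M) := by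
  have energy : ∀ θ ∈ I, 2 * gam P1 P2 θ + E1 θ ^ 2 = K2 := by
    intro θ hθ
    have h := hI.norm_image_sub_le_of_norm_hasDerivWithin_le (C := 0)
      (fun t ht => hasDerivWithinAt_energy (hP1 t ht).hasDerivWithinAt
        (hP2 t ht).hasDerivWithinAt (hE1 t ht).hasDerivWithinAt) (by simp) h0 hθ
    rw [zero_mul, norm_le_zero_iff, sub_eq_zero] at h
    exact h.trans hK2.symm
  have bounds : ∀ θ ∈ I, gam P1 P2 θ ≤ K2 / 2 ∧ E1 θ ^ 2 ≤ K2 - 2 := fun θ hθ =>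
    ⟨by linarith [energy θ hθ, sq_nonneg (E1 θ)],
      by linarith [energy θ hθ, one_le_gam P1 P2 θ]⟩
  refine ⟨bounds, max (K2 / 2) (Real.sqrt (K2 - 2)), fun θ hθ => ?_⟩
  obtain ⟨hγ, hE⟩ := bounds θ hθ
  exact ⟨le_max_of_le_left ((abs_fst_le_gam P1 P2 θ).trans hγ),
    le_max_of_le_left ((abs_snd_le_gam P1 P2 θ).trans hγ),
    le_max_of_le_right (Real.abs_le_sqrt hE)⟩
end

section
/- Let B0 ≠ 0 and let (P1, P2, E1) : I → ℝ³ be a C¹ solution on an interval I containing 0 of the characteristic system dP1/dθ = −E1 − B0 P2/γ, dP2/dθ = B0 P1/γ, dE1/dθ = P1/γ, where γ = √(1 + P1² + P2²). Set K1 = P2(0) − B0 E1(0) and K2 = 2√(1 + P1(0)² + P2(0)²) + E1(0)². Then for all θ ∈ I, P2 = P2(θ) satisfies the identity (B0² K2 − (P2 − K1)²)² · (dP2/dθ)² = B0² [ (B0² K2 − (P2 − K1)²)² − 4 B0⁴ (1 + P2²) ]. -/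
open Real Set

/-- A real function with vanishing derivative on a convex set is constant there. -/
theorem Convex.eq_of_hasDerivAt_zero {I : Set ℝ} (hI : Convex ℝ I) {f : ℝ → ℝ}
    (hf : ∀ t ∈ I, HasDerivAt f 0 t) {x y : ℝ} (hx : x ∈ I) (hy : y ∈ I) : f x = f y := by
  have h := hI.norm_image_sub_le_of_norm_hasDerivWithin_le (C := 0)
    (fun t ht => (hf t ht).hasDerivWithinAt) (by simp) hy hx
  rwa [zero_mul, norm_le_zero_iff, sub_eq_zero] at h

theorem gam_sq (P1 P2 : ℝ → ℝ) (θ : ℝ) : gam P1 P2 θ ^ 2 = 1 + P1 θ ^ 2 + P2 θ ^ 2 :=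
  Real.sq_sqrt (by positivity)

theorem HasDerivAt.gam {P1 P2 : ℝ → ℝ} {p q θ : ℝ} (h1 : HasDerivAt P1 p θ)
    (h2 : HasDerivAt P2 q θ) :
    HasDerivAt (gam P1 P2) ((P1 θ * p + P2 θ * q) / gam P1 P2 θ) θ := by
  have h := (((h1.pow 2).const_add 1).add (h2.pow 2)).sqrt
    (by simp only [Pi.add_apply, Pi.pow_apply]; positivity)
  refine h.congr_deriv ?_
  change _ / (2 * _root_.gam P1 P2 θ) = _
  have := (gam_pos P1 P2 θ).ne'
  field_simp
  push_cast
  ring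

/-- Along any `C¹` solution of the characteristic system on an interval `I ∋ 0`, with
`K1 = P2(0) − B0 E1(0)` and `K2 = 2√(1 + P1(0)² + P2(0)²) + E1(0)²`, the component `P2`
satisfies `(B0²K2 − (P2 − K1)²)² (P2′)² = B0² [(B0²K2 − (P2 − K1)²)² − 4B0⁴(1 + P2²)]`. -/
theorem P2_equation
    (B0 : ℝ) (hB0 : B0 ≠ 0) (I : Set ℝ) (hI : Convex ℝ I) (h0 : (0 : ℝ) ∈ I)
    (P1 P2 E1 : ℝ → ℝ)
    (hP1 : ∀ θ ∈ I, HasDerivAt P1 (-(E1 θ) - B0 * P2 θ / gam P1 P2 θ) θ)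
    (hP2 : ∀ θ ∈ I, HasDerivAt P2 (B0 * P1 θ / gam P1 P2 θ) θ)
    (hE1 : ∀ θ ∈ I, HasDerivAt E1 (P1 θ / gam P1 P2 θ) θ)
    (K1 K2 : ℝ) (hK1 : K1 = P2 0 - B0 * E1 0)
    (hK2 : K2 = 2 * Real.sqrt (1 + P1 0 ^ 2 + P2 0 ^ 2) + E1 0 ^ 2) :
    ∀ θ ∈ I,
      (B0 ^ 2 * K2 - (P2 θ - K1) ^ 2) ^ 2 * (deriv P2 θ) ^ 2 =
      B0 ^ 2 * ((B0 ^ 2 * K2 - (P2 θ - K1) ^ 2) ^ 2 - 4 * B0 ^ 4 * (1 + P2 θ ^ 2)) := by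
  intro θ hθ
  have hne (t : ℝ) : gam P1 P2 t ≠ 0 := (gam_pos P1 P2 t).ne'
  have first_integral : P2 θ - B0 * E1 θ = K1 := by
    rw [hK1]
    refine hI.eq_of_hasDerivAt_zero (f := fun t => P2 t - B0 * E1 t) (fun t ht => ?_) hθ h0
    exact ((hP2 t ht).sub ((hE1 t ht).const_mul B0)).congr_deriv (by ring)
  have energy : 2 * gam P1 P2 θ + E1 θ ^ 2 = K2 := by
    rw [hK2]
    refine hI.eq_of_hasDerivAt_zero (f := fun t => 2 * gam P1 P2 t + E1 t ^ 2)
      (fun t ht => ?_) hθ h0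
    refine ((((hP1 t ht).gam (hP2 t ht)).const_mul 2).add ((hE1 t ht).pow 2)).congr_deriv ?_
    have := hne t
    field_simp
    push_cast
    ring
  have reduced : B0 ^ 2 * K2 - (P2 θ - K1) ^ 2 = 2 * B0 ^ 2 * gam P1 P2 θ := by
    rw [← first_integral, ← energy]
    ring
  have := hne θ
  rw [reduced, (hP2 θ hθ).deriv]
  field_simp
  linear_combination (-4) * gam_sq P1 P2 θ
end

section
/- Let B0 ∈ ℝ, let (P1, P2, E1) : I → ℝ³ be a C¹ solution on an interval I containing 0 of the characteristic system dP1/dθ = −E1 − B0 P2/γ, dP2/dθ = B0 P1/γ, dE1/dθ = P1/γ (γ = √(1 + P1² + P2²)), and let (p1, p2, e) : I → ℝ³ be C¹ functions satisfying the extended system dp1/dθ = −q1 p1 − B0 q2 − e, dp2/dθ = −q1 p2 + B0 q1, de/dθ = (1 − e) q1, where qᵢ = pᵢ/γ − Pᵢ (p1 P1 + p2 P2)/γ³ for i = 1,2. If e(0) ≠ 1, then e(θ) ≠ 1 for all θ ∈ I and p2(θ) − B0 = C1 (e(θ) − 1) for all θ ∈ I, where C1 = (p2(0) − B0)/(e(0)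 − 1). -/
open Real Set

/-- `Q = (p1 P1 + p2 P2)/γ³`. -/
noncomputable def Qv (P1 P2 p1 p2 : ℝ → ℝ) (θ : ℝ) : ℝ :=
  (p1 θ * P1 θ + p2 θ * P2 θ) / (gam P1 P2 θ) ^ 3

/-- `q1 = p1/γ − P1 (p1 P1 + p2 P2)/γ³`. -/
noncomputable def q1v (P1 P2 p1 p2 : ℝ → ℝ) (θ : ℝ) : ℝ :=
  p1 θ / gam P1 P2 θ - P1 θ * Qv P1 P2 p1 p2 θ

/-- `q2 = p2/γ − P2 (p1 P1 + p2 P2)/γ³`. -/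
noncomputable def q2v (P1 P2 p1 p2 : ℝ → ℝ) (θ : ℝ) : ℝ :=
  p2 θ / gam P1 P2 θ - P2 θ * Qv P1 P2 p1 p2 θ

/-- Solutions of the scalar linear equation `y' = a y` on a convex set are transported from `s`
to `t` by multiplication with a positive factor that does not depend on the solution. -/
lemma exists_pos_transport_of_linear_ode {I : Set ℝ} (hI : Convex ℝ I) {a : ℝ → ℝ}
    (ha : ContinuousOn a I) {s t : ℝ} (hs : s ∈ I) (ht : t ∈ I) :
    ∃ c : ℝ, 0 < c ∧ ∀ y : ℝ → ℝ, (∀ x ∈ I, HasDerivAt y (a x * y x) x) → y t = c * y s := by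
  have hsub : uIcc s t ⊆ I := by
    rw [← segment_eq_uIcc]
    exact hI.segment_subset hs ht
  let b : ℝ → ℝ := IccExtend (inf_le_sup : s ⊓ t ≤ s ⊔ t) ((Icc (s ⊓ t) (s ⊔ t)).domRestrict a)
  have hb : Continuous b := (ha.mono hsub).domRestrict.Icc_extend'
  have hba : ∀ x ∈ uIcc s t, b x = a x := fun x hx => IccExtend_of_mem _ _ hx
  let A : ℝ → ℝ := fun x => ∫ u in s..x, b u
  have hA : ∀ x, HasDerivAt A (b x) x := fun x => (hb.integral_hasStrictDerivAt s x).hasDerivAt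
  refine ⟨Real.exp (A t), Real.exp_pos _, fun y hy => ?_⟩
  have hconst : ∀ x ∈ uIcc s t,
      HasDerivWithinAt (fun x => y x * Real.exp (-A x)) 0 (uIcc s t) x := by
    intro x hx
    refine (((hy x (hsub hx)).mul (hA x).neg.exp).congr_deriv ?_).hasDerivWithinAt
    rw [hba x hx]
    ring
  have hle := (convex_uIcc s t).norm_image_sub_le_of_norm_hasDerivWithin_le (C := 0) hconst
    (fun _ _ => by simp) left_mem_uIcc right_mem_uIcc
  rw [zero_mul, norm_le_zero_iff, sub_eq_zero] at hle
  have hAs : A s = 0 := intervalIntegral.integral_same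
  simp only [hAs, neg_zero, Real.exp_zero, mul_one] at hle
  rw [← hle, mul_left_comm, ← Real.exp_add, add_neg_cancel, Real.exp_zero, mul_one]

lemma continuousOn_q1v {I : Set ℝ} {P1 P2 p1 p2 : ℝ → ℝ} (hP1 : ContinuousOn P1 I)
    (hP2 : ContinuousOn P2 I) (hp1 : ContinuousOn p1 I) (hp2 : ContinuousOn p2 I) :
    ContinuousOn (q1v P1 P2 p1 p2) I := by
  have hg : ContinuousOn (gam P1 P2) I :=
    ((continuousOn_const.add (hP1.pow 2)).add (hP2.pow 2)).sqrt
  have hg0 : ∀ x, gam P1 P2 x ≠ 0 := fun x => (Real.sqrt_pos.2 (by positivity)).ne'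
  exact (hp1.div hg fun x _ => hg0 x).sub
    (hP1.mul (((hp1.mul hP1).add (hp2.mul hP2)).div (hg.pow 3) fun x _ => pow_ne_zero 3 (hg0 x)))

/-- First integral of the extended characteristic system: if `e(0) ≠ 1` then `e ≠ 1` on
all of `I` and `p2 − B0 = C1 (e − 1)` with `C1 = (p2(0) − B0)/(e(0) − 1)`. -/
theorem extended_system_first_integral
    (B0 : ℝ) (I : Set ℝ) (hI : Convex ℝ I) (h0 : (0 : ℝ) ∈ I)
    (P1 P2 E1 p1 p2 e : ℝ → ℝ)
    (hP1 : ∀ θ ∈ I, HasDerivAt P1 (-(E1 θ) - B0 * P2 θ / gam P1 P2 θ) θ)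
    (hP2 : ∀ θ ∈ I, HasDerivAt P2 (B0 * P1 θ / gam P1 P2 θ) θ)
    (hE1 : ∀ θ ∈ I, HasDerivAt E1 (P1 θ / gam P1 P2 θ) θ)
    (hp1 : ∀ θ ∈ I, HasDerivAt p1
      (-(q1v P1 P2 p1 p2 θ) * p1 θ - B0 * q2v P1 P2 p1 p2 θ - e θ) θ)
    (hp2 : ∀ θ ∈ I, HasDerivAt p2
      (-(q1v P1 P2 p1 p2 θ) * p2 θ + B0 * q1v P1 P2 p1 p2 θ) θ)
    (he : ∀ θ ∈ I, HasDerivAt e ((1 - e θ) * q1v P1 P2 p1 p2 θ) θ)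
    (he0 : e 0 ≠ 1) :
    ∀ θ ∈ I, e θ ≠ 1 ∧ p2 θ - B0 = (p2 0 - B0) / (e 0 - 1) * (e θ - 1) := by
  intro θ hθ
  have hq : ContinuousOn (q1v P1 P2 p1 p2) I := continuousOn_q1v
    (fun x hx => (hP1 x hx).continuousAt.continuousWithinAt)
    (fun x hx => (hP2 x hx).continuousAt.continuousWithinAt)
    (fun x hx => (hp1 x hx).continuousAt.continuousWithinAt)
    (fun x hx => (hp2 x hx).continuousAt.continuousWithinAt)
  obtain ⟨c, hc, hy⟩ := exists_pos_transport_of_linear_ode hI hq.neg h0 hθ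
  have hsube : e θ - 1 = c * (e 0 - 1) := hy (fun x => e x - 1) fun x hx =>
    ((he x hx).sub_const 1).congr_deriv (by simp only [Pi.neg_apply]; ring)
  have hsubp : p2 θ - B0 = c * (p2 0 - B0) := hy (fun x => p2 x - B0) fun x hx =>
    ((hp2 x hx).sub_const B0).congr_deriv (by simp only [Pi.neg_apply]; ring)
  have hne : e 0 - 1 ≠ 0 := sub_ne_zero.2 he0
  refine ⟨sub_ne_zero.1 (hsube ▸ mul_ne_zero hc.ne' hne), ?_⟩
  rw [hsube, hsubp]
  field_simp
end

section
/- Let B0 ∈ ℝ, let (P1, P2, E1) be a C¹ solution of the characteristic system dP1/dθ = −E1 − B0 P2/γ, dP2/dθ = B0 P1/γ, dE1/dθ = P1/γ (γ = √(1+P1²+P2²)) on an interval I, and let (p1, p2, e) be a C¹ solution on I of the extended system dp1/dθ = −q1 p1 − B0 q2 − e, dp2/dθ = −q1 p2 + B0 q1, de/dθ = (1 − e) q1, where qᵢ = pᵢ/γ − Pᵢ(p1P1 + p2P2)/γ³. Suppose p1(θ) ≠ 0 on I and set u = e/p1, λ = (e−1)/p1, σ = p2/p1. Then on I: du/dθ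 = u² + B0(1+P1²)uσ/γ³ − B0 P1P2 u/γ³ − P1P2 σ/γ³ + (1+P2²)/γ³; dλ/dθ = λ ( u + B0(1+P1²)σ/γ³ − B0 P1P2/γ³ ); dσ/dθ = B0(1+P1²)σ²/γ³ + uσ − 2B0 P1P2 σ/γ³ + B0(1+P2²)/γ³. -/
open Real Set

theorem gam_ne_zero (P1 P2 : ℝ → ℝ) (θ : ℝ) : gam P1 P2 θ ≠ 0 :=
  (Real.sqrt_pos.2 (by positivity)).ne'

theorem q1v_eq (P1 P2 p1 p2 : ℝ → ℝ) (θ : ℝ) :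
    q1v P1 P2 p1 p2 θ =
      ((1 + P2 θ ^ 2) * p1 θ - P1 θ * P2 θ * p2 θ) / gam P1 P2 θ ^ 3 := by
  have hg := gam_ne_zero P1 P2 θ
  unfold q1v Qv
  field_simp
  rw [gam_sq]
  ring

theorem q2v_eq (P1 P2 p1 p2 : ℝ → ℝ) (θ : ℝ) :
    q2v P1 P2 p1 p2 θ =
      ((1 + P1 θ ^ 2) * p2 θ - P1 θ * P2 θ * p1 θ) / gam P1 P2 θ ^ 3 := by
  have hg := gam_ne_zero P1 P2 θ
  unfold q2v Qv
  field_simp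
  rw [gam_sq]
  ring

/-- In the variables `u = e/p1`, `λ = (e−1)/p1`, `σ = p2/p1`, the extended
characteristic system becomes the system (14)–(16) of the paper. -/
theorem u_lambda_sigma_system
    (B0 : ℝ) (I : Set ℝ) (P1 P2 E1 p1 p2 e : ℝ → ℝ)
    (hP1 : ∀ θ ∈ I, HasDerivAt P1 (-(E1 θ) - B0 * P2 θ / gam P1 P2 θ) θ)
    (hP2 : ∀ θ ∈ I, HasDerivAt P2 (B0 * P1 θ / gam P1 P2 θ) θ)
    (hE1 : ∀ θ ∈ I, HasDerivAt E1 (P1 θ / gam P1 P2 θ) θ)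
    (hp1 : ∀ θ ∈ I, HasDerivAt p1
      (-(q1v P1 P2 p1 p2 θ) * p1 θ - B0 * q2v P1 P2 p1 p2 θ - e θ) θ)
    (hp2 : ∀ θ ∈ I, HasDerivAt p2
      (-(q1v P1 P2 p1 p2 θ) * p2 θ + B0 * q1v P1 P2 p1 p2 θ) θ)
    (he : ∀ θ ∈ I, HasDerivAt e ((1 - e θ) * q1v P1 P2 p1 p2 θ) θ)
    (hp1ne : ∀ θ ∈ I, p1 θ ≠ 0) :
    (∀ θ ∈ I, HasDerivAt (fun t => e t / p1 t)
      ((e θ / p1 θ) ^ 2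
        + B0 * (1 + P1 θ ^ 2) / (gam P1 P2 θ) ^ 3 * (e θ / p1 θ) * (p2 θ / p1 θ)
        - B0 * (P1 θ * P2 θ) / (gam P1 P2 θ) ^ 3 * (e θ / p1 θ)
        - P1 θ * P2 θ / (gam P1 P2 θ) ^ 3 * (p2 θ / p1 θ)
        + (1 + P2 θ ^ 2) / (gam P1 P2 θ) ^ 3) θ) ∧
    (∀ θ ∈ I, HasDerivAt (fun t => (e t - 1) / p1 t)
      ((e θ - 1) / p1 θ *
        (e θ / p1 θ
          + B0 * (1 + P1 θ ^ 2) / (gam P1 P2 θ) ^ 3 * (p2 θ / p1 θ)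
          - B0 * (P1 θ * P2 θ) / (gam P1 P2 θ) ^ 3)) θ) ∧
    (∀ θ ∈ I, HasDerivAt (fun t => p2 t / p1 t)
      (B0 * (1 + P1 θ ^ 2) / (gam P1 P2 θ) ^ 3 * (p2 θ / p1 θ) ^ 2
        + (e θ / p1 θ) * (p2 θ / p1 θ)
        - 2 * B0 * (P1 θ * P2 θ) / (gam P1 P2 θ) ^ 3 * (p2 θ / p1 θ)
        + B0 * (1 + P2 θ ^ 2) / (gam P1 P2 θ) ^ 3) θ) := by
  refine ⟨fun θ hθ => ?_, fun θ hθ => ?_, fun θ hθ => ?_⟩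
  · have hg := gam_ne_zero P1 P2 θ
    have hp := hp1ne θ hθ
    refine ((he θ hθ).fun_div (hp1 θ hθ) hp).congr_deriv ?_
    rw [q1v_eq, q2v_eq]
    field_simp
    ring
  · have hg := gam_ne_zero P1 P2 θ
    have hp := hp1ne θ hθ
    refine (((he θ hθ).sub_const 1).fun_div (hp1 θ hθ) hp).congr_deriv ?_
    rw [q1v_eq, q2v_eq]
    field_simp
    ring
  · have hg := gam_ne_zero P1 P2 θ
    have hp := hp1ne θ hθ
    refine ((hp2 θ hθ).fun_div (hp1 θ hθ) hp).congr_deriv ?_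
    rw [q1v_eq, q2v_eq]
    field_simp
    ring
end

section
/- Let B0, C1 ∈ ℝ and let F1, F2, F3 : I → ℝ be continuous functions on an interval I. Suppose u, λ : I → ℝ are C¹, λ(θ) ≠ 0 on I, and satisfy du/dθ = (1 + B0² F1) u² + B0(C1 − B0) F1 uλ − 2 B0 F2 u − (C1 − B0) F2 λ + F3 and dλ/dθ = (1 + B0² F1) uλ + B0(C1 − B0) F1 λ² − B0 F2 λ. Then q1 = u/λ and q2 = 1/λ satisfy the linear inhomogeneous system dq1/dθ = −B0 F2 q1 + F3 q2 − (C1 − B0) F2 and dq2/dθ = −(1 + B0² F1) q1 + B0 F2 q2 − B0(C1 − B0) F1 on I. -/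
open Real Set

/-- If `u, λ` solve the quadratic reduced system with coefficients `F1, F2, F3` and
`λ ≠ 0`, then `q1 = u/λ` and `q2 = 1/λ` solve the linear inhomogeneous system
(18)–(19) of the paper. -/
theorem linearization_q1_q2
    (B0 C1 : ℝ) (I : Set ℝ) (F1 F2 F3 : ℝ → ℝ)
    (hF1 : ContinuousOn F1 I) (hF2 : ContinuousOn F2 I) (hF3 : ContinuousOn F3 I)
    (u lam : ℝ → ℝ)
    (hlamne : ∀ θ ∈ I, lam θ ≠ 0)
    (hu : ∀ θ ∈ I, HasDerivAt u
      ((1 + B0 ^ 2 * F1 θ) * u θ ^ 2 + B0 * (C1 - B0) * F1 θ * u θ * lam θ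
        - 2 * B0 * F2 θ * u θ - (C1 - B0) * F2 θ * lam θ + F3 θ) θ)
    (hlam : ∀ θ ∈ I, HasDerivAt lam
      ((1 + B0 ^ 2 * F1 θ) * u θ * lam θ + B0 * (C1 - B0) * F1 θ * lam θ ^ 2
        - B0 * F2 θ * lam θ) θ) :
    (∀ θ ∈ I, HasDerivAt (fun t => u t / lam t)
      (-(B0 * F2 θ) * (u θ / lam θ) + F3 θ * (1 / lam θ)
        - (C1 - B0) * F2 θ) θ) ∧
    (∀ θ ∈ I, HasDerivAt (fun t => 1 / lam t)
      (-(1 + B0 ^ 2 * F1 θ) * (u θ / lam θ) + B0 * F2 θ * (1 / lam θ)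
        - B0 * (C1 - B0) * F1 θ) θ) := by
  refine ⟨fun θ hθ => ?_, fun θ hθ => ?_⟩
  · have hne := hlamne θ hθ
    refine ((hu θ hθ).fun_div (hlam θ hθ) hne).congr_deriv ?_
    field_simp
    ring
  · have hne := hlamne θ hθ
    refine ((hasDerivAt_const θ (1 : ℝ)).fun_div (hlam θ hθ) hne).congr_deriv ?_
    field_simp
    ring
end
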